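/- arXiv:0706.4015 — 4 statements merged into one kernel-verified Lean document; each statement's English description precedes it below -/
import Mathlib

section
/- The predicate WU is closed under steps of the unison protocol: if WU(γ) holds and γ ↦ γ' is an NA-step (a nonempty set S of processes at which the normal action NA is enabled in γ simultaneously execute it, all other processes keeping their value), then WU(γ') holds. -/
open SimpleGraph

/-- The incrementing function `φ`: `φ(x) = (x+1) mod K` if `x ≥ 0`, and `x+1` if `x < 0`. -/
def phiInc (K x : ℤ) : ℤ := if 0 ≤ x then (x + 1) % K else x + 1

/-- Two ring values are locally comparable if `min((a−b) mod K, (b−a) mod K) ≤ 1`. -/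
def LocComp (K a b : ℤ) : Prop := min ((a - b) % K) ((b - a) % K) ≤ 1

/-- The predicate `WU`: every process has a ring value (`{0,…,K−1}`) locally comparable
with the value of each of its neighbors. -/
def WU {V : Type*} (G : SimpleGraph V) (K : ℤ) (γ : V → ℤ) : Prop :=
  ∀ p q : V, G.Adj p q → (0 ≤ γ p ∧ γ p < K) ∧ LocComp K (γ p) (γ q)

/-- The normal action `NA` is enabled at `p`: `γ(p)` is a ring value and every neighbor `q`
satisfies `γ(q) = γ(p)` or `γ(q) = φ(γ(p))`. -/
def NAenabled {V : Type*} (G : SimpleGraph V) (K : ℤ) (γ : V → ℤ) (p : V) : Prop :=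
  (0 ≤ γ p ∧ γ p < K) ∧ ∀ q : V, G.Adj p q → γ q = γ p ∨ γ q = phiInc K (γ p)

/-- An NA-step: a nonempty set `S` of processes at which `NA` is enabled in `γ`
simultaneously execute it, all other processes keeping their value. -/
def NAstep {V : Type*} (G : SimpleGraph V) (K : ℤ) (γ γ' : V → ℤ) (S : Set V) : Prop :=
  S.Nonempty ∧ (∀ p ∈ S, NAenabled G K γ p) ∧
    ∀ p : V, (p ∈ S → γ' p = phiInc K (γ p)) ∧ (p ∉ S → γ' p = γ p)

theorem phiInc_mem_ring {K a : ℤ} (hK : 0 < K) (ha : 0 ≤ a) :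
    0 ≤ phiInc K a ∧ phiInc K a < K := by
  rw [phiInc, if_pos ha]
  exact ⟨Int.emod_nonneg _ hK.ne', Int.emod_lt_of_pos _ hK⟩

theorem locComp_self (K a : ℤ) : LocComp K a a := by
  simp [LocComp]

theorem LocComp.symm {K a b : ℤ} (h : LocComp K a b) : LocComp K b a := by
  rwa [LocComp, min_comm]

theorem locComp_phiInc {K a : ℤ} (hK : 1 < K) (ha : 0 ≤ a) : LocComp K a (phiInc K a) := by
  have h : (phiInc K a - a) % K = 1 := by
    rw [phiInc, if_pos ha, Int.emod_sub_emod, add_sub_cancel_left]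
    exact Int.emod_eq_of_lt zero_le_one hK
  exact (min_le_right _ _).trans h.le

/-- The predicate `WU` is closed under steps of the unison protocol: if `WU(γ)` holds and
`γ ↦ γ'` is an NA-step, then `WU(γ')` holds. -/
theorem WU_closed {V : Type*} [Fintype V] (G : SimpleGraph V)
    (hconn : G.Connected) (hn : 2 ≤ Fintype.card V)
    (K α : ℤ) (hK : 3 ≤ K) (hα : 0 ≤ α)
    (γ γ' : V → ℤ) (hX : ∀ p : V, -α ≤ γ p ∧ γ p < K)
    (S : Set V) (hWU : WU G K γ) (hstep : NAstep G K γ γ' S) :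
    WU G K γ' := by
  have hK1 : 1 < K := by lia
  have hK0 : 0 < K := by lia
  obtain ⟨-, hen, hval⟩ := hstep
  have key : ∀ p q : V, G.Adj p q → p ∈ S → LocComp K (γ' p) (γ' q) := by
    intro p q hpq hp
    obtain ⟨⟨ha, -⟩, hnbr⟩ := hen p hp
    have hφ := (phiInc_mem_ring hK0 ha).1
    rw [(hval p).1 hp]
    by_cases hq : q ∈ S
    · rw [(hval q).1 hq]
      rcases hnbr q hpq with h | h <;> rw [h]
      · exact locComp_self _ _
      · exact locComp_phiInc hK1 hφ
    · rw [(hval q).2 hq]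
      rcases hnbr q hpq with h | h <;> rw [h]
      · exact (locComp_phiInc hK1 ha).symm
      · exact locComp_self _ _
  intro p q hpq
  obtain ⟨hring, hcomp⟩ := hWU p q hpq
  by_cases hp : p ∈ S
  · refine ⟨?_, key p q hpq hp⟩
    rw [(hval p).1 hp]
    exact phiInc_mem_ring hK0 hring.1
  · refine ⟨by rwa [(hval p).2 hp], ?_⟩
    by_cases hq : q ∈ S
    · exact (key q p hpq.symm hq).symm
    · rwa [(hval p).2 hp, (hval q).2 hq]
end

section
/- No configuration in WU₀ is a deadlock: if γ satisfies WU₀ and p is a process that is minimal for the precedence preorder defined by the intrinsic delay (i.e., δ(p,q) ≥ 0 for every process q), then the normal action NA is enabled at p in γ (every neighbor q of p satisfies γ(q) = γ(p) or γ(q) = φ(γ(p))). -/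
open SimpleGraph

/-- `dsub K a b` is `b ⊖ a`: `(b−a) mod K` if this residue is `≤ 1`, else `−((a−b) mod K)`. -/
def dsub (K a b : ℤ) : ℤ := if (b - a) % K ≤ 1 then (b - a) % K else -((a - b) % K)

/-- The delay of a walk: the sum of `γ(next) ⊖ γ(current)` along its edges. -/
def walkDelay {V : Type*} {G : SimpleGraph V} (K : ℤ) (γ : V → ℤ)
    {p q : V} (w : G.Walk p q) : ℤ :=
  (w.darts.map (fun d => dsub K (γ d.fst) (γ d.snd))).sum

/-- The delay is intrinsic: independent of the choice of the path. -/
def Intrinsic {V : Type*} (G : SimpleGraph V) (K : ℤ) (γ : V → ℤ) : Prop :=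
  ∀ p q : V, ∀ w₁ w₂ : G.Walk p q, walkDelay K γ w₁ = walkDelay K γ w₂

/-- A ring value `b` with `b ⊖ a ≥ 0` is either `a` or its successor in the ring. -/
theorem eq_or_eq_phiInc_of_dsub_nonneg {K a b : ℤ} (ha : 0 ≤ a ∧ a < K) (hb : 0 ≤ b ∧ b < K)
    (h : 0 ≤ dsub K a b) : b = a ∨ b = phiInc K a := by
  have hK : 0 < K := ha.1.trans_lt ha.2
  have hmod {x y : ℤ} (hx : 0 ≤ x ∧ x < K) (hxy : K ∣ x - y) : y % K = x := by
    rw [← Int.emod_eq_emod_iff_emod_sub_eq_zero.mpr (Int.emod_eq_zero_of_dvd hxy)]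
    exact Int.emod_eq_of_lt hx.1 hx.2
  have hba := Int.emod_nonneg (b - a) hK.ne'
  have hab := Int.emod_nonneg (a - b) hK.ne'
  rw [phiInc, if_pos ha.1]
  unfold dsub at h
  split_ifs at h with hle
  · obtain h0 | h1 : (b - a) % K = 0 ∨ (b - a) % K = 1 := by omega
    · left
      rw [← hmod hb (Int.dvd_of_emod_eq_zero h0), Int.emod_eq_of_lt ha.1 ha.2]
    · right
      refine (hmod hb ?_).symm
      have hdvd := Int.dvd_self_sub_of_emod_eq h1
      rwa [sub_sub] at hdvd
  · left
    have h0 : (a - b) % K = 0 := by omega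
    rw [← hmod ha (Int.dvd_of_emod_eq_zero h0), Int.emod_eq_of_lt hb.1 hb.2]

/-- No configuration in `WU₀` is a deadlock: if `γ` satisfies `WU₀` (that is, `WU` holds and
the delay is intrinsic) and `p` is minimal for the precedence preorder defined by the
intrinsic delay (`δ(p,q) ≥ 0` for every `q`, i.e., every walk from `p` to any `q` has
nonnegative delay), then the normal action `NA` is enabled at `p` in `γ`: every neighbor `q`
of `p` satisfies `γ(q) = γ(p)` or `γ(q) = φ(γ(p))`. -/
theorem minimal_process_enabled {V : Type*} [Fintype V] (G : SimpleGraph V)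
    (hconn : G.Connected) (hn : 2 ≤ Fintype.card V)
    (K α : ℤ) (hK : 3 ≤ K) (hα : 0 ≤ α)
    (γ : V → ℤ) (hX : ∀ p : V, -α ≤ γ p ∧ γ p < K)
    (hWU : WU G K γ) (hintr : Intrinsic G K γ)
    (p : V) (hmin : ∀ q : V, ∀ w : G.Walk p q, 0 ≤ walkDelay K γ w) :
    (0 ≤ γ p ∧ γ p < K) ∧ ∀ q : V, G.Adj p q → γ q = γ p ∨ γ q = phiInc K (γ p) := by
  have : Nontrivial V := Fintype.one_lt_card_iff_nontrivial.mp hn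
  obtain ⟨r, hr⟩ := hconn.preconnected.exists_adj_of_nontrivial p
  have hp := (hWU p r hr).1
  refine ⟨hp, fun q hq => ?_⟩
  refine eq_or_eq_phiInc_of_dsub_nonneg hp (hWU q p hq.symm).1 ?_
  simpa [walkDelay] using hmin q hq.toWalk
end

section
/- In any execution from a configuration in WU₀: (i) if (p,t) ⤳ (q,t') is a causal edge, then the lifted clock satisfies ṽ(q,t') ∈ {ṽ(p,t), ṽ(p,t)+1}; (ii) inductively, if (q₀,t₀) ⤳ (q₁,t₁) ⤳ … ⤳ (q_i,t_i) is a causal chain of length i, then ṽ(q_i,t_i) − ṽ(q₀,t₀) ∈ {0, 1, …, i}. -/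
open SimpleGraph

/-- `γ` takes values in `X = {−α,…,K−1}`. -/
def InX {V : Type*} (K α : ℤ) (γ : V → ℤ) : Prop := ∀ p : V, -α ≤ γ p ∧ γ p < K

/-- `WU₀`: `WU` together with intrinsic delay. -/
def WU0 {V : Type*} (G : SimpleGraph V) (K : ℤ) (γ : V → ℤ) : Prop :=
  WU G K γ ∧ Intrinsic G K γ

/-- `(p,t)` is an event: `t = 0`, or `p` executes `NA` in the step `γ_{t−1} ↦ γ_t`. -/
def isEvent {V : Type*} (sched : ℕ → Set V) (p : V) (t : ℕ) : Prop :=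
  t = 0 ∨ ∃ s, t = s + 1 ∧ p ∈ sched s

/-- The causal relation `⤳` on events. -/
inductive Leads {V : Type*} (G : SimpleGraph V) (sched : ℕ → Set V) :
    V × ℕ → V × ℕ → Prop
  | self {p : V} {t' t : ℕ} : isEvent sched p t' → isEvent sched p t → t' < t →
      (∀ s, t' < s → s < t → ¬ isEvent sched p s) → Leads G sched (p, t') (p, t)
  | nbr {p q : V} {t' t : ℕ} : G.Adj p q → isEvent sched p t → 0 < t →
      isEvent sched q t' → t' < t → (∀ s, t' < s → s < t → ¬ isEvent sched q s) →
      Leads G sched (q, t') (p, t)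

/-- The causal order `≼`: reflexive-transitive closure of `⤳`. -/
def CausalLe {V : Type*} (G : SimpleGraph V) (sched : ℕ → Set V) :
    V × ℕ → V × ℕ → Prop :=
  Relation.ReflTransGen (Leads G sched)

/-- The lifted clock `ṽ(p,t) = ⊥₀ + δ(p₀,p) + #{s : 0 < s ≤ t and (p,s) is an event}`. -/
noncomputable def liftClock {V : Type*} (sched : ℕ → Set V) (bot0 : ℤ) (δ0 : V → ℤ)
    (p : V) (t : ℕ) : ℤ :=
  bot0 + δ0 p + Nat.card {s : ℕ // 0 < s ∧ s ≤ t ∧ isEvent sched p s}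

theorem isEvent_succ_iff {V : Type*} (sched : ℕ → Set V) (p : V) (t : ℕ) :
    isEvent sched p (t + 1) ↔ p ∈ sched t := by
  simp [isEvent]

theorem liftClock_zero {V : Type*} (sched : ℕ → Set V) (b : ℤ) (δ : V → ℤ) (p : V) :
    liftClock sched b δ p 0 = b + δ p := by
  have : IsEmpty {s : ℕ // 0 < s ∧ s ≤ 0 ∧ isEvent sched p s} :=
    ⟨fun ⟨s, h₁, h₂, _⟩ => by omega⟩
  rw [liftClock, Nat.card_of_isEmpty, Nat.cast_zero, add_zero]

theorem liftClock_eq_card_filter {V : Type*} (sched : ℕ → Set V) (b : ℤ) (δ : V → ℤ) (p : V)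
    (t : ℕ) [DecidablePred (isEvent sched p)] :
    liftClock sched b δ p t = b + δ p + ((Finset.Ioc 0 t).filter (isEvent sched p)).card := by
  rw [liftClock, Nat.subtype_card ((Finset.Ioc 0 t).filter (isEvent sched p))
    fun s => by simp [and_assoc]]

theorem liftClock_succ_of_mem {V : Type*} {sched : ℕ → Set V} {p : V} {t : ℕ} (b : ℤ) (δ : V → ℤ)
    (h : p ∈ sched t) : liftClock sched b δ p (t + 1) = liftClock sched b δ p t + 1 := by
  classical
  have hI : Finset.Ioc 0 (t + 1) = insert (t + 1) (Finset.Ioc 0 t) := by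
    ext; simp; omega
  rw [liftClock_eq_card_filter, liftClock_eq_card_filter, hI, Finset.filter_insert,
    if_pos ((isEvent_succ_iff sched p t).2 h), Finset.card_insert_of_notMem (by simp)]
  push_cast
  ring

theorem liftClock_succ_of_not_mem {V : Type*} {sched : ℕ → Set V} {p : V} {t : ℕ} (b : ℤ)
    (δ : V → ℤ) (h : p ∉ sched t) :
    liftClock sched b δ p (t + 1) = liftClock sched b δ p t := by
  classical
  have hI : Finset.Ioc 0 (t + 1) = insert (t + 1) (Finset.Ioc 0 t) := by
    ext; simp; omega
  rw [liftClock_eq_card_filter, liftClock_eq_card_filter, hI, Finset.filter_insert,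
    if_neg (mt (isEvent_succ_iff sched p t).1 h)]

theorem liftClock_eq_of_no_event {V : Type*} {sched : ℕ → Set V} {p : V} {t t' : ℕ} (b : ℤ)
    (δ : V → ℤ) (hle : t' ≤ t) (h : ∀ s, t' < s → s ≤ t → ¬ isEvent sched p s) :
    liftClock sched b δ p t = liftClock sched b δ p t' := by
  induction t, hle using Nat.le_induction with
  | base => rfl
  | succ t ht ih =>
    rw [liftClock_succ_of_not_mem b δ
      (mt (isEvent_succ_iff sched p t).2 (h _ (by omega) le_rfl))]
    exact ih fun s h₁ h₂ => h s h₁ (by omega)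

theorem dvd_phiInc_sub (K x : ℤ) : K ∣ phiInc K x - (x + 1) := by
  unfold phiInc
  split_ifs
  · exact (Int.mod_modEq (x + 1) K).symm.dvd
  · simp

theorem dvd_dsub_sub (K a b : ℤ) : K ∣ dsub K a b - (b - a) := by
  unfold dsub
  split_ifs
  · exact (Int.mod_modEq (b - a) K).symm.dvd
  · have := (Int.mod_modEq (a - b) K).dvd
    rwa [show -((a - b) % K) - (b - a) = a - b - (a - b) % K by ring]

theorem LocComp.abs_dsub_le {K a b : ℤ} (hK : 0 < K) (h : LocComp K a b) :
    |dsub K a b| ≤ 1 := by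
  have h₁ := Int.emod_nonneg (b - a) hK.ne'
  have h₂ := Int.emod_nonneg (a - b) hK.ne'
  unfold LocComp at h
  unfold dsub
  rw [abs_le]
  split_ifs <;> omega

theorem dvd_walkDelay_sub {V : Type*} {G : SimpleGraph V} (K : ℤ) (γ : V → ℤ) {p q : V}
    (w : G.Walk p q) : K ∣ walkDelay K γ w - (γ q - γ p) := by
  induction w with
  | nil => simp [walkDelay]
  | @cons u v x h w ih =>
    have := Int.dvd_add (dvd_dsub_sub K (γ u) (γ v)) ih
    convert this using 1
    simp [walkDelay]
    ring

theorem Int.eq_zero_of_dvd_of_abs_lt_three {K d : ℤ} (hK : 3 ≤ K) (hd : K ∣ d) (h : |d| < 3) :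
    d = 0 :=
  Int.eq_zero_of_abs_lt_dvd hd (by omega)

section Execution

variable {V : Type*} {G : SimpleGraph V} {K : ℤ} {e : ℕ → V → ℤ} {sched : ℕ → Set V}
  {b : ℤ} {δ : V → ℤ}

theorem dvd_sub_liftClock (hexec : ∀ t, NAstep G K (e t) (e (t + 1)) (sched t))
    (hzero : ∀ p, K ∣ e 0 p - (b + δ p)) (t : ℕ) (p : V) :
    K ∣ e t p - liftClock sched b δ p t := by
  induction t with
  | zero => simpa [liftClock_zero] using hzero p
  | succ t ih =>
    obtain ⟨hact, hidle⟩ := (hexec t).2.2 p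
    by_cases h : p ∈ sched t
    · rw [liftClock_succ_of_mem b δ h, hact h]
      convert Int.dvd_add (dvd_phiInc_sub K (e t p)) ih using 1
      ring
    · rwa [liftClock_succ_of_not_mem b δ h, hidle h]

theorem liftClock_of_NAenabled (hK : 3 ≤ K)
    (hexec : ∀ t, NAstep G K (e t) (e (t + 1)) (sched t))
    (hzero : ∀ p, K ∣ e 0 p - (b + δ p)) {t : ℕ} {p q : V} (hadj : G.Adj p q)
    (hen : NAenabled G K (e t) p)
    (hclose : |liftClock sched b δ q t - liftClock sched b δ p t| ≤ 1) :
    liftClock sched b δ q t = liftClock sched b δ p t ∨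
      liftClock sched b δ q t = liftClock sched b δ p t + 1 := by
  have hp := dvd_sub_liftClock hexec hzero t p
  have hq := dvd_sub_liftClock hexec hzero t q
  have hφ := dvd_phiInc_sub K (e t p)
  rw [abs_le] at hclose
  rcases hen.2 q hadj with h | h <;> rw [h] at hq
  · left
    have := Int.eq_zero_of_dvd_of_abs_lt_three hK (dvd_sub hp hq) (by rw [abs_lt]; omega)
    omega
  · right
    have hd : K ∣ liftClock sched b δ q t - (liftClock sched b δ p t + 1) := by
      convert Int.dvd_sub (Int.dvd_add hφ hp) hq using 1
      ring
    have := Int.eq_zero_of_dvd_of_abs_lt_three hK hd (by rw [abs_lt]; omega)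
    omega

theorem abs_liftClock_sub_le (hK : 3 ≤ K)
    (hexec : ∀ t, NAstep G K (e t) (e (t + 1)) (sched t))
    (hzero : ∀ p, K ∣ e 0 p - (b + δ p))
    (hδ : ∀ p q, G.Adj p q → |δ q - δ p| ≤ 1) (t : ℕ) {p q : V} (hadj : G.Adj p q) :
    |liftClock sched b δ q t - liftClock sched b δ p t| ≤ 1 := by
  induction t with
  | zero => simpa [liftClock_zero] using hδ p q hadj
  | succ t ih =>
    have hp := fun h : p ∈ sched t =>
      liftClock_of_NAenabled hK hexec hzero hadj ((hexec t).2.1 p h) ih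
    have hq := fun h : q ∈ sched t =>
      liftClock_of_NAenabled hK hexec hzero hadj.symm ((hexec t).2.1 q h) (by rwa [abs_sub_comm])
    rw [abs_le] at ih ⊢
    by_cases h₁ : p ∈ sched t <;> by_cases h₂ : q ∈ sched t <;>
      simp only [liftClock_succ_of_mem, liftClock_succ_of_not_mem, h₁, h₂, not_false_eq_true,
        forall_const, false_imp_iff] at hp hq ⊢ <;>
      omega

theorem liftClock_of_leads (hK : 3 ≤ K)
    (hexec : ∀ t, NAstep G K (e t) (e (t + 1)) (sched t))
    (hzero : ∀ p, K ∣ e 0 p - (b + δ p))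
    (hδ : ∀ p q, G.Adj p q → |δ q - δ p| ≤ 1) {x y : V × ℕ} (h : Leads G sched x y) :
    liftClock sched b δ y.1 y.2 = liftClock sched b δ x.1 x.2 ∨
      liftClock sched b δ y.1 y.2 = liftClock sched b δ x.1 x.2 + 1 := by
  cases h with
  | @self p t' t _ ht hlt hno =>
    obtain ⟨t, rfl⟩ := Nat.exists_eq_add_one.2 (by omega : 0 < t)
    right
    rw [isEvent_succ_iff] at ht
    dsimp only
    rw [liftClock_succ_of_mem b δ ht, liftClock_eq_of_no_event b δ (Nat.le_of_lt_succ hlt)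
      fun s h₁ h₂ => hno s h₁ (by omega)]
  | @nbr p q t' t hadj ht hpos _ hlt hno =>
    obtain ⟨t, rfl⟩ := Nat.exists_eq_add_one.2 hpos
    rw [isEvent_succ_iff] at ht
    dsimp only
    rw [liftClock_succ_of_mem b δ ht, ← liftClock_eq_of_no_event b δ (Nat.le_of_lt_succ hlt)
      fun s h₁ h₂ => hno s h₁ (by omega)]
    have := liftClock_of_NAenabled hK hexec hzero hadj ((hexec t).2.1 p ht)
      (abs_liftClock_sub_le hK hexec hzero hδ t hadj)
    omega

end Execution

/-- In any execution from a configuration in `WU₀`: (i) if `(p,t) ⤳ (q,t')` is a causal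
edge, then the lifted clock satisfies `ṽ(q,t') ∈ {ṽ(p,t), ṽ(p,t)+1}`; (ii) inductively,
along any causal chain `(q₀,t₀) ⤳ (q₁,t₁) ⤳ … ⤳ (q_i,t_i)` of length `i`, one has
`ṽ(q_i,t_i) − ṽ(q₀,t₀) ∈ {0, 1, …, i}`.  Here `⊥₀ = γ₀(p₀)` for a process `p₀` minimal
for the precedence preorder in `γ₀`, and `δ0` is the intrinsic delay from `p₀` in `γ₀`. -/
theorem lifted_clock_causal {V : Type*} [Fintype V] (G : SimpleGraph V)
    (hconn : G.Connected) (hn : 2 ≤ Fintype.card V)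
    (K α : ℤ) (hK : 3 ≤ K) (hα : 0 ≤ α)
    (e : ℕ → V → ℤ) (sched : ℕ → Set V)
    (hX : ∀ t, ∀ p : V, -α ≤ e t p ∧ e t p < K)
    (hWU0 : WU G K (e 0) ∧ Intrinsic G K (e 0))
    (hexec : ∀ t, NAstep G K (e t) (e (t + 1)) (sched t))
    (p₀ : V) (δ0 : V → ℤ)
    (hδ0 : ∀ q : V, ∀ w : G.Walk p₀ q, walkDelay K (e 0) w = δ0 q)
    (hmin : ∀ q : V, 0 ≤ δ0 q) :
    (∀ (p q : V) (t t' : ℕ), Leads G sched (p, t) (q, t') →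
        liftClock sched (e 0 p₀) δ0 q t' = liftClock sched (e 0 p₀) δ0 p t ∨
        liftClock sched (e 0 p₀) δ0 q t' = liftClock sched (e 0 p₀) δ0 p t + 1) ∧
    (∀ (i : ℕ) (c : ℕ → V × ℕ), (∀ j < i, Leads G sched (c j) (c (j + 1))) →
        0 ≤ liftClock sched (e 0 p₀) δ0 (c i).1 (c i).2 -
              liftClock sched (e 0 p₀) δ0 (c 0).1 (c 0).2 ∧
        liftClock sched (e 0 p₀) δ0 (c i).1 (c i).2 -
              liftClock sched (e 0 p₀) δ0 (c 0).1 (c 0).2 ≤ (i : ℤ)) := by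
  have hzero : ∀ p, K ∣ e 0 p - (e 0 p₀ + δ0 p) := by
    intro p
    obtain ⟨w⟩ := hconn.preconnected p₀ p
    have := dvd_walkDelay_sub K (e 0) w
    rw [hδ0 p w, ← Int.dvd_neg] at this
    convert this using 1
    ring
  have hδ : ∀ p q, G.Adj p q → |δ0 q - δ0 p| ≤ 1 := by
    intro p q hadj
    obtain ⟨w⟩ := hconn.preconnected p₀ p
    have hd : δ0 q = δ0 p + dsub K (e 0 p) (e 0 q) := by
      rw [← hδ0 p w, ← hδ0 q (w.concat hadj)]
      simp [walkDelay]
    rw [hd, add_sub_cancel_left]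
    exact (hWU0.1 p q hadj).2.abs_dsub_le (by omega)
  refine ⟨fun p q t t' h => liftClock_of_leads hK hexec hzero hδ h, fun i c hc => ?_⟩
  induction i with
  | zero => simp
  | succ i ih =>
    have h₁ := ih fun j hj => hc j (by omega)
    have h₂ := liftClock_of_leads hK hexec hzero hδ (hc i (by omega))
    push_cast
    omega
end

section
/- No starvation / liveness: let γ₀ be a configuration satisfying WU₀ and let γ₀, γ₁, … be an infinite execution consisting of NA-steps. Then every process executes NA (i.e., increments its clock) infinitely often. (The proof uses that the potential Pot_p = Σ_{q∈V} δ(p,q) is bounded in absolute value by n·D while it would increase without bound if p were starved.) -/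
open SimpleGraph

/-- On ring values, `phiInc` has no fixed point. -/
lemma phiInc_ne_self {K x : ℤ} (hK : 2 ≤ K) (h0 : 0 ≤ x) (h1 : x < K) : phiInc K x ≠ x := by
  rw [phiInc, if_pos h0]
  rcases eq_or_ne (x + 1) K with h | h
  · rw [h, Int.emod_self]; omega
  · rw [Int.emod_eq_of_lt (by omega) (by omega)]; omega

/-- On ring values, `phiInc` has no point of period two. -/
lemma phiInc_phiInc_ne_self {K x : ℤ} (hK : 3 ≤ K) (h0 : 0 ≤ x) (h1 : x < K) :
    phiInc K (phiInc K x) ≠ x := by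
  have h2 : phiInc K x = (x + 1) % K := by rw [phiInc, if_pos h0]
  rw [h2, phiInc, if_pos (Int.emod_nonneg _ (by omega))]
  rcases eq_or_ne (x + 1) K with h | h
  · rw [h, Int.emod_self, Int.emod_eq_of_lt (by omega) (by omega)]; omega
  · rw [Int.emod_eq_of_lt (a := x + 1) (by omega) (by omega)]
    rcases eq_or_ne (x + 1 + 1) K with h' | h'
    · rw [h', Int.emod_self]; omega
    · rw [Int.emod_eq_of_lt (by omega) (by omega)]; omega

/-- If a process is idle from some time on, so is each of its neighbors. -/
lemma eventually_idle_of_adj {V : Type*} {G : SimpleGraph V} {K : ℤ} (hK : 3 ≤ K)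
    {e : ℕ → V → ℤ} {sched : ℕ → Set V}
    (hexec : ∀ t, NAstep G K (e t) (e (t + 1)) (sched t)) {p q : V} (hpq : G.Adj p q)
    {T : ℕ} (hp : ∀ t, T ≤ t → p ∉ sched t) :
    ∃ T', ∀ t, T' ≤ t → q ∉ sched t := by
  by_contra! hq
  have hconst : ∀ t, T ≤ t → e t p = e T p := fun t ht => by
    induction t, ht using Nat.le_induction with
    | base => rfl
    | succ t ht ih => rw [((hexec t).2.2 p).2 (hp t ht), ih]
  set x := e T p
  have hfire : ∀ t, T ≤ t → q ∈ sched t →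
      (0 ≤ e t q ∧ e t q < K) ∧ (x = e t q ∨ x = phiInc K (e t q)) ∧
        e (t + 1) q = phiInc K (e t q) := fun t ht hqt => by
    have h := (hexec t).2.1 q hqt
    refine ⟨h.1, ?_, ((hexec t).2.2 q).1 hqt⟩
    simpa only [hconst t ht] using h.2 p hpq.symm
  have hblocked : ∀ t, T ≤ t → e t q = phiInc K x → q ∉ sched t := fun t ht hx hqt => by
    obtain ⟨⟨h0, h1⟩, h | h, -⟩ := hfire t ht hqt
    · exact phiInc_ne_self (by omega) h0 h1 ((congrArg (phiInc K) h).symm.trans hx.symm)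
    · exact phiInc_phiInc_ne_self hK h0 h1 ((congrArg (phiInc K) h).symm.trans hx.symm)
  have hstuck : ∀ t₀, T ≤ t₀ → e t₀ q ≠ phiInc K x := fun t₀ ht₀ hx => by
    have hstay : ∀ t, t₀ ≤ t → e t q = phiInc K x := fun t ht => by
      induction t, ht using Nat.le_induction with
      | base => exact hx
      | succ t ht ih =>
        rw [((hexec t).2.2 q).2 (hblocked t (ht₀.trans ht) ih), ih]
    obtain ⟨t, ht, hqt⟩ := hq t₀
    exact hblocked t (ht₀.trans ht) (hstay t ht) hqt
  have hnext : ∀ t, T ≤ t → q ∈ sched t → e (t + 1) q = x := fun t ht hqt => by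
    obtain ⟨-, h | h, h'⟩ := hfire t ht hqt
    · exact absurd (h'.trans (congrArg (phiInc K) h).symm) (hstuck _ (by omega))
    · exact h'.trans h.symm
  obtain ⟨t₁, ht₁, hq₁⟩ := hq T
  have hstay : ∀ t, t₁ + 1 ≤ t → e t q = x := fun t ht => by
    induction t, ht using Nat.le_induction with
    | base => exact hnext t₁ ht₁ hq₁
    | succ t ht ih =>
      by_cases hqt : q ∈ sched t
      · exact hnext t (by omega) hqt
      · rw [((hexec t).2.2 q).2 hqt, ih]
  obtain ⟨t₂, ht₂, hq₂⟩ := hq (t₁ + 1)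
  have h := (hfire t₂ (by omega) hq₂).2.2
  rw [hstay t₂ ht₂] at h
  exact hstuck (t₂ + 1) (by omega) h

/-- No starvation / liveness: if `γ₀` satisfies `WU₀` (that is, `WU` holds and the delay is
intrinsic in `γ₀`) and `γ₀, γ₁, …` is an infinite execution consisting of NA-steps, then
every process executes `NA` (i.e., increments its clock) infinitely often. -/
theorem no_starvation {V : Type*} [Fintype V] (G : SimpleGraph V)
    (hconn : G.Connected) (hn : 2 ≤ Fintype.card V)
    (K α : ℤ) (hK : 3 ≤ K) (hα : 0 ≤ α)
    (e : ℕ → V → ℤ) (sched : ℕ → Set V)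
    (hX : ∀ t, ∀ p : V, -α ≤ e t p ∧ e t p < K)
    (hWU0 : WU G K (e 0) ∧ Intrinsic G K (e 0))
    (hexec : ∀ t, NAstep G K (e t) (e (t + 1)) (sched t)) :
    ∀ (p : V) (T : ℕ), ∃ t, T ≤ t ∧ p ∈ sched t := by
  intro p T
  by_contra! hp
  have hall : ∀ q : V, ∃ T, ∀ t, T ≤ t → q ∉ sched t := fun q => by
    obtain ⟨w⟩ := hconn.preconnected p q
    have key : ∀ {a b : V}, G.Walk a b → (∃ T, ∀ t, T ≤ t → a ∉ sched t) →
        ∃ T, ∀ t, T ≤ t → b ∉ sched t := by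
      intro a b w
      induction w with
      | nil => exact id
      | cons h _ ih =>
        exact fun ⟨T, hT⟩ => ih (eventually_idle_of_adj hK hexec h hT)
    exact key w ⟨T, hp⟩
  choose N hN using hall
  obtain ⟨q, hq⟩ := (hexec (Finset.univ.sup N)).1
  exact hN q _ (Finset.le_sup (Finset.mem_univ q)) hq
end
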